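/- Let R > 0, l ∈ ℝ, r := l + R, t* ∈ ℝ, v ∈ ℝ, and let x₁, x₂ : ℝ → ℝ satisfy x₁(t*) = r, x₂(t*) = r, with x₁ having left derivative v at t* (derivative within (−∞, t*]) and x₂ having right derivative −v at t* (derivative within [t*, ∞)). Define q : ℝ → ℝ by q(t) = (x₁(t) − l)/R for t ≤ t* and q(t) = 2 − (x₂(t) − l)/R for t > t*. Then q(t*) = 1 and q is differentiable at t* with q'(t*) = v/R. -/

import Mathlib

/-- The lifted coordinate passes smoothly through an impact: if `x₁` hits the
wall `r = l + R` at time `t*` with left velocity `v` and `x₂` leaves the wall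
with right velocity `−v`, then the lifted coordinate `q`, defined as
`(x₁ − l)/R` before the impact and `2 − (x₂ − l)/R` after it, satisfies
`q(t*) = 1` and is differentiable at `t*` with `q'(t*) = v/R`. -/
theorem lifted_coordinate_smooth_through_impact
    (R l r tStar v : ℝ) (hR : 0 < R) (hr : r = l + R)
    (x₁ x₂ : ℝ → ℝ) (h₁ : x₁ tStar = r) (h₂ : x₂ tStar = r)
    (hd₁ : HasDerivWithinAt x₁ v (Set.Iic tStar) tStar)
    (hd₂ : HasDerivWithinAt x₂ (-v) (Set.Ici tStar) tStar)
    (q : ℝ → ℝ)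
    (hq : ∀ t : ℝ, q t = if t ≤ tStar then (x₁ t - l) / R else 2 - (x₂ t - l) / R) :
    q tStar = 1 ∧ HasDerivAt q (v / R) tStar := by
  have hRx : (r - l) / R = 1 := by
    rw [hr, add_sub_cancel_left, div_self hR.ne']
  have hq₀ : q tStar = 1 := by rw [hq, if_pos le_rfl, h₁, hRx]
  refine ⟨hq₀, ?_⟩
  have hleft : HasDerivWithinAt q (v / R) (Set.Iic tStar) tStar :=
    ((hd₁.sub_const l).div_const R).congr
      (fun t ht => by rw [hq, if_pos (Set.mem_Iic.mp ht)]) (by rw [hq, if_pos le_rfl])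
  have hright : HasDerivWithinAt q (v / R) (Set.Ici tStar) tStar := by
    have h := ((hd₂.sub_const l).div_const R).const_sub 2
    rw [neg_div, neg_neg] at h
    have hwall : q tStar = 2 - (x₂ tStar - l) / R := by
      rw [hq₀, h₂, hRx]
      norm_num
    refine h.congr (fun t ht => ?_) hwall
    rcases (Set.mem_Ici.mp ht).eq_or_lt with rfl | hlt
    · exact hwall
    · rw [hq, if_neg hlt.not_ge]
  have h := hleft.union hright
  rwa [Set.Iic_union_Ici, hasDerivWithinAt_univ] at h
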